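/- Let p = a/b > 1 where a and b are coprime positive integers with a > b, and let n̂ be a positive integer. Then for every real x with 0 ≤ x ≤ (2^b+1)·n̂ + 2^b, it holds that 2^(a−b)·(x+1)^p + ((2^b+1)·n̂ + 2^b − x)^p ≥ (2^a + 2^(a−b))·(n̂+1)^p, with the minimum attained at x = n̂. -/

import Mathlib

/-- The graph of `y ↦ y ^ p` lies above its tangent line at `c`. -/
lemma rpow_tangent_le {p c y : ℝ} (hp : 1 ≤ p) (hc : 0 < c) (hy : 0 ≤ y) :
    c ^ p * (1 + p * (y / c - 1)) ≤ y ^ p := by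
  have hyc : 0 ≤ y / c := div_nonneg hy hc.le
  have bernoulli := one_add_mul_self_le_rpow_one_add (s := y / c - 1) (by linarith) hp
  rw [add_sub_cancel] at bernoulli
  calc c ^ p * (1 + p * (y / c - 1)) ≤ c ^ p * (y / c) ^ p := by gcongr
    _ = y ^ p := by rw [← Real.mul_rpow hc.le hyc, mul_div_cancel₀ _ hc.ne']

lemma two_pow_mul_rpow_div (a : ℕ) {b : ℕ} (hb : b ≠ 0) {y : ℝ} (hy : 0 ≤ y) :
    (2 ^ b * y) ^ ((a : ℝ) / b) = 2 ^ a * y ^ ((a : ℝ) / b) := by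
  have hb' : (b : ℝ) ≠ 0 := by exact_mod_cast hb
  rw [Real.mul_rpow (by positivity) hy, ← Real.rpow_natCast 2 b, ← Real.rpow_mul (by norm_num),
    mul_div_cancel₀ _ hb', Real.rpow_natCast]

theorem stmt_15 (a b : ℕ) (hb : 0 < b) (hab : b < a) (hcop : Nat.Coprime a b)
    (nh : ℕ) (hnh : 0 < nh) :
    (∀ x : ℝ, 0 ≤ x → x ≤ (2 ^ b + 1) * (nh : ℝ) + 2 ^ b →
      (2 ^ a + 2 ^ (a - b)) * ((nh : ℝ) + 1) ^ ((a : ℝ) / b)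
        ≤ 2 ^ (a - b) * (x + 1) ^ ((a : ℝ) / b)
          + ((2 ^ b + 1) * (nh : ℝ) + 2 ^ b - x) ^ ((a : ℝ) / b))
    ∧ 2 ^ (a - b) * ((nh : ℝ) + 1) ^ ((a : ℝ) / b)
        + ((2 ^ b + 1) * (nh : ℝ) + 2 ^ b - (nh : ℝ)) ^ ((a : ℝ) / b)
      = (2 ^ a + 2 ^ (a - b)) * ((nh : ℝ) + 1) ^ ((a : ℝ) / b) := by
  have hN : (0 : ℝ) < nh + 1 := by positivity
  have hp : 1 ≤ (a : ℝ) / b := by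
    rw [one_le_div (by exact_mod_cast hb)]
    exact_mod_cast hab.le
  have hpow : (2 : ℝ) ^ a = 2 ^ (a - b) * 2 ^ b := by
    rw [← pow_add, Nat.sub_add_cancel hab.le]
  have hscale := two_pow_mul_rpow_div a hb.ne' hN.le
  refine ⟨fun x hx hx' => ?_, ?_⟩
  · have h₁ := rpow_tangent_le hp hN (y := x + 1) (by linarith)
    have h₂ := rpow_tangent_le hp (c := 2 ^ b * ((nh : ℝ) + 1)) (by positivity)
      (sub_nonneg.2 hx')
    rw [hscale] at h₂
    refine le_trans (le_of_eq ?_) (add_le_add (mul_le_mul_of_nonneg_left h₁ (by positivity)) h₂)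
    rw [hpow]
    field_simp
    ring
  · rw [show (2 ^ b + 1) * (nh : ℝ) + 2 ^ b - nh = 2 ^ b * (nh + 1) by ring, hscale]
    ring
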